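/- Let n ≥ 2 and let u : ℝⁿ → ℝⁿ be a smooth vector field with compact support. Then 2 ∫_{ℝⁿ} |e(u)|² dμ = ∫_{ℝⁿ} |Du|² dμ + ∫_{ℝⁿ} (e(u))² dμ, and consequently ∫_{ℝⁿ} |Du|² dμ ≤ 2 ∫_{ℝⁿ} |e(u)|² dμ (Korn's inequality in the first case). -/

import Mathlib

open MeasureTheory Finset

/-- Partial derivative `∂ᵢ f` of a scalar function on `ℝⁿ`. -/
noncomputable def pd {n : ℕ} (f : (Fin n → ℝ) → ℝ) (i : Fin n) (x : Fin n → ℝ) : ℝ :=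
  fderiv ℝ f x (Pi.single i 1)

/-- Linearized strain tensor `e_{ij}(u) = (∂ᵢ u_j + ∂ⱼ u_i)/2`. -/
noncomputable def strain {n : ℕ} (u : (Fin n → ℝ) → Fin n → ℝ) (i j : Fin n)
    (x : Fin n → ℝ) : ℝ :=
  (pd (fun y => u y j) i x + pd (fun y => u y i) j x) / 2

/-- The trace `e(u) = Σᵢ ∂ᵢ uᵢ`, i.e. the divergence of `u`. -/
noncomputable def diver {n : ℕ} (u : (Fin n → ℝ) → Fin n → ℝ) (x : Fin n → ℝ) : ℝ :=
  ∑ i, pd (fun y => u y i) i x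

/-- Trace-free part `l_{ij}(u) = e_{ij}(u) − (1/n) e(u) δ_{ij}`. -/
noncomputable def ltf {n : ℕ} (u : (Fin n → ℝ) → Fin n → ℝ) (i j : Fin n)
    (x : Fin n → ℝ) : ℝ :=
  strain u i j x - (1 / (n : ℝ)) * diver u x * (if i = j then 1 else 0)

section PartialDerivatives

variable {n : ℕ} {f g : (Fin n → ℝ) → ℝ}

theorem contDiff_pd (hf : ContDiff ℝ (⊤ : ℕ∞) f) (i : Fin n) :
    ContDiff ℝ (⊤ : ℕ∞) (pd f i) :=
  (hf.fderiv_right (m := ((⊤ : ℕ∞) : WithTop ℕ∞)) (by simp)).clm_apply contDiff_const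

theorem hasCompactSupport_pd (hf : HasCompactSupport f) (i : Fin n) :
    HasCompactSupport (pd f i) :=
  hf.fderiv_apply ℝ (Pi.single i 1)

theorem pd_pd_eq_fderiv_fderiv (hf : ContDiff ℝ (⊤ : ℕ∞) f) (i j : Fin n) (x : Fin n → ℝ) :
    pd (pd f i) j x = fderiv ℝ (fderiv ℝ f) x (Pi.single j 1) (Pi.single i 1) := by
  have hd : DifferentiableAt ℝ (fderiv ℝ f) x :=
    (hf.fderiv_right (m := ((⊤ : ℕ∞) : WithTop ℕ∞)) (by simp)).differentiable (by simp) x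
  change fderiv ℝ (fun y => fderiv ℝ f y (Pi.single i 1)) x (Pi.single j 1) = _
  rw [fderiv_clm_apply hd (differentiableAt_const _)]
  simp

theorem pd_comm (hf : ContDiff ℝ (⊤ : ℕ∞) f) (i j : Fin n) (x : Fin n → ℝ) :
    pd (pd f i) j x = pd (pd f j) i x := by
  rw [pd_pd_eq_fderiv_fderiv hf, pd_pd_eq_fderiv_fderiv hf]
  exact (hf.contDiffAt.isSymmSndFDerivAt
    (by simpa using ENat.LEInfty.out)).eq _ _

theorem integrable_mul_of_hasCompactSupport (hf : Continuous f) (hg : Continuous g)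
    (hfs : HasCompactSupport f) : Integrable (fun x => f x * g x) :=
  (hf.mul hg).integrable_of_hasCompactSupport hfs.mul_right

theorem integral_mul_pd (hf : ContDiff ℝ (⊤ : ℕ∞) f) (hg : ContDiff ℝ (⊤ : ℕ∞) g)
    (hfs : HasCompactSupport f) (i : Fin n) :
    ∫ x, f x * pd g i x = -∫ x, pd f i x * g x :=
  integral_mul_fderiv_eq_neg_fderiv_mul_of_integrable
    (integrable_mul_of_hasCompactSupport (contDiff_pd hf i).continuous hg.continuous
      (hasCompactSupport_pd hfs i))
    (integrable_mul_of_hasCompactSupport hf.continuous (contDiff_pd hg i).continuous hfs)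
    (integrable_mul_of_hasCompactSupport hf.continuous hg.continuous hfs)
    (fun x _ => hf.differentiable (by simp) x) (fun x _ => hg.differentiable (by simp) x)

/-- Two integrations by parts exchange the directions of the derivatives in a product. -/
theorem integral_pd_mul_pd_comm (hf : ContDiff ℝ (⊤ : ℕ∞) f) (hg : ContDiff ℝ (⊤ : ℕ∞) g)
    (hfs : HasCompactSupport f) (i j : Fin n) :
    ∫ x, pd f i x * pd g j x = ∫ x, pd f j x * pd g i x := by
  rw [integral_mul_pd (contDiff_pd hf i) hg (hasCompactSupport_pd hfs i),
    integral_mul_pd (contDiff_pd hf j) hg (hasCompactSupport_pd hfs j)]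
  simp only [pd_comm hf i j]

end PartialDerivatives

theorem two_mul_sum_strain_sq {n : ℕ} (u : (Fin n → ℝ) → Fin n → ℝ) (x : Fin n → ℝ) :
    2 * ∑ i, ∑ j, strain u i j x ^ 2 =
      (∑ i, ∑ j, pd (fun y => u y j) i x ^ 2) +
        ∑ i, ∑ j, pd (fun y => u y j) i x * pd (fun y => u y i) j x := by
  have hswap : ∑ i, ∑ j, pd (fun y => u y i) j x ^ 2 = ∑ i, ∑ j, pd (fun y => u y j) i x ^ 2 :=
    sum_comm
  have hsq : ∀ i j, strain u i j x ^ 2 = (1 / 4) * pd (fun y => u y j) i x ^ 2 +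
      (1 / 4) * pd (fun y => u y i) j x ^ 2 +
      (1 / 2) * (pd (fun y => u y j) i x * pd (fun y => u y i) j x) := by
    intro i j
    unfold strain
    ring
  simp only [hsq, sum_add_distrib, ← mul_sum, hswap]
  ring

/-- **Korn's inequality in the first case**: for `n ≥ 2` and a smooth compactly supported
vector field `u` on `ℝⁿ`, `2∫|e(u)|² = ∫|Du|² + ∫(e(u))²`, hence `∫|Du|² ≤ 2∫|e(u)|²`. -/
theorem korn_first_case (n : ℕ) (hn : 2 ≤ n) (u : (Fin n → ℝ) → Fin n → ℝ)
    (hu : ContDiff ℝ (⊤ : ℕ∞) u) (hsupp : HasCompactSupport u) :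
    2 * (∫ x, ∑ i, ∑ j, strain u i j x ^ 2) =
        (∫ x, ∑ i, ∑ j, pd (fun y => u y j) i x ^ 2) + ∫ x, diver u x ^ 2 ∧
      (∫ x, ∑ i, ∑ j, pd (fun y => u y j) i x ^ 2) ≤
        2 * ∫ x, ∑ i, ∑ j, strain u i j x ^ 2 := by
  have hc : ∀ i, ContDiff ℝ (⊤ : ℕ∞) (fun y => u y i) := contDiff_pi.mp hu
  have hs : ∀ i, HasCompactSupport (fun y => u y i) := fun i =>
    hsupp.comp_left (g := fun v : Fin n → ℝ => v i) rfl
  have hint : ∀ i j k l, Integrable (fun x => pd (fun y => u y i) k x * pd (fun y => u y j) l x) :=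
    fun i j k l => integrable_mul_of_hasCompactSupport (contDiff_pd (hc i) k).continuous
      (contDiff_pd (hc j) l).continuous (hasCompactSupport_pd (hs i) k)
  have hD : Integrable (fun x => ∑ i, ∑ j, pd (fun y => u y j) i x ^ 2) := by
    simp only [sq]
    exact integrable_finsetSum _ fun i _ => integrable_finsetSum _ fun j _ => hint j j i i
  have hX : Integrable (fun x => ∑ i, ∑ j, pd (fun y => u y j) i x * pd (fun y => u y i) j x) :=
    integrable_finsetSum _ fun i _ => integrable_finsetSum _ fun j _ => hint j i i j
  have hdiv : ∫ x, ∑ i, ∑ j, pd (fun y => u y j) i x * pd (fun y => u y i) j x =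
      ∫ x, diver u x ^ 2 := by
    simp only [diver, sq, sum_mul_sum]
    rw [integral_finsetSum _ fun i _ => integrable_finsetSum _ fun j _ => hint j i i j,
      integral_finsetSum _ fun i _ => integrable_finsetSum _ fun j _ => hint i j i j]
    refine sum_congr rfl fun i _ => ?_
    rw [integral_finsetSum _ fun j _ => hint j i i j,
      integral_finsetSum _ fun j _ => hint i j i j]
    refine sum_congr rfl fun j _ => ?_
    rw [integral_pd_mul_pd_comm (hc j) (hc i) (hs j)]
    simp only [mul_comm]
  have key : 2 * (∫ x, ∑ i, ∑ j, strain u i j x ^ 2) =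
      (∫ x, ∑ i, ∑ j, pd (fun y => u y j) i x ^ 2) + ∫ x, diver u x ^ 2 := by
    rw [← integral_const_mul, ← hdiv, ← integral_add hD hX]
    simp only [two_mul_sum_strain_sq]
  refine ⟨key, ?_⟩
  have hnonneg : 0 ≤ ∫ x, diver u x ^ 2 := integral_nonneg fun x => sq_nonneg _
  linarith
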